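/- Strong boundedness of the regularized pairings: with C, C′, δ, k, γ, g, r and f as in the Fourier–Laplace setting (g bounded continuous, supp g ⊆ C*, f(z) = (2π)^{−n}(−iz)^γ ∫ e^{k|ξ|₁} g(ξ) e^{i⟨ξ,z⟩} dξ holomorphic for y ∈ C′, |y| ≥ r), let ψ ∈ 𝔥(T(ℝⁿ)) and let φ(ξ) = (2π)^{−n} ∫_{ℝⁿ} ψ(x) e^{i⟨ξ,x⟩} dx. Define G_ψ(y) = (−1)^{|γ|} ∫_{ℝⁿ} e^{k|ξ|₁} g(ξ) D^γ_ξ [ e^{−⟨ξ,y⟩} φ(ξ) ] dξ for y ∈ C′ ∪ {0}. Then: (a) G_ψ(y) is an absolutely convergent integral for every y ∈ C′ ∪ {0}; (b) for y ∈ C′ with |y| ≥ r one has G_ψ(y) = ∫_{ℝⁿ} f(x+iy) ψ(x) dx; and (c) for every Q > 0, sup_{y ∈ C′, |y| ≤ Q} |G_ψ(y)| < ∞. -/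

import Mathlib

open MeasureTheory Complex Filter Topology

noncomputable section

/-- Partial derivative in the `i`-th coordinate direction. -/
def pd {n : ℕ} (i : Fin n) (f : (Fin n → ℝ) → ℂ) : (Fin n → ℝ) → ℂ :=
  fun x => fderiv ℝ f x (Pi.single i 1)

/-- Multi-index derivative `D^α`. -/
def Dm {n : ℕ} (α : Fin n → ℕ) (f : (Fin n → ℝ) → ℂ) : (Fin n → ℝ) → ℂ :=
  (List.finRange n).foldr (fun i g => (pd i)^[α i] g) f

/-- Order `|α|` of a multi-index. -/
def mOrd {n : ℕ} (α : Fin n → ℕ) : ℕ := ∑ i, α i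

/-- Supporting function `h_K(ξ) = sup_{x ∈ K} ⟨ξ,x⟩` of a set `K`. -/
def hSupp {n : ℕ} (K : Set (Fin n → ℝ)) (ξ : Fin n → ℝ) : ℝ :=
  sSup ((fun x => ∑ i, ξ i * x i) '' K)

/-- The ℓ¹ norm `|ξ|₁ = ∑ i |ξ i|`. -/
def n1 {n : ℕ} (ξ : Fin n → ℝ) : ℝ := ∑ i, |ξ i|

/-- The vector of imaginary parts of `z ∈ ℂⁿ`. -/
def imv {n : ℕ} (z : Fin n → ℂ) : Fin n → ℝ := fun i => (z i).im

/-- Euclidean norm `|z|` on `ℂⁿ`. -/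
def cnorm {n : ℕ} (z : Fin n → ℂ) : ℝ := Real.sqrt (∑ i, ‖z i‖ ^ 2)

/-- Euclidean norm on `ℝⁿ`. -/
def en {n : ℕ} (y : Fin n → ℝ) : ℝ := Real.sqrt (∑ i, y i ^ 2)

/-- `C` is a cone with vertex at the origin: `ℝ₊ · C ⊆ C`. -/
def IsCone {n : ℕ} (C : Set (Fin n → ℝ)) : Prop :=
  ∀ t : ℝ, 0 < t → ∀ x ∈ C, t • x ∈ C

/-- The dual cone `C* = {ξ : ⟨ξ,y⟩ ≥ 0 for all y ∈ C}`. -/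
def dualCone {n : ℕ} (C : Set (Fin n → ℝ)) : Set (Fin n → ℝ) :=
  {ξ | ∀ y ∈ C, 0 ≤ ∑ i, ξ i * y i}

/-- `C′ ⋐ C`: the cone `C′` is compact in the cone `C`, i.e. the projection
`(closure C′) ∩ S^{n−1}` is contained in `C ∩ S^{n−1}`. -/
def CmpSub {n : ℕ} (C' C : Set (Fin n → ℝ)) : Prop :=
  IsCone C' ∧ closure C' ∩ {y | en y = 1} ⊆ C ∩ {y | en y = 1}

/-- The Fourier–Laplace transform
`f(z) = (2π)^{−n} (−iz)^γ ∫ e^{k|ξ|₁} g(ξ) e^{i⟨ξ,z⟩} dξ`. -/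
def FL {n : ℕ} (k : ℝ) (γ : Fin n → ℕ) (g : (Fin n → ℝ) → ℂ) (z : Fin n → ℂ) : ℂ :=
  (((2 * Real.pi) ^ n : ℝ) : ℂ)⁻¹ * (∏ j, (-Complex.I * z j) ^ γ j) *
    ∫ ξ : Fin n → ℝ,
      (Real.exp (k * n1 ξ) : ℂ) * g ξ * Complex.exp (Complex.I * ∑ i, (ξ i : ℂ) * z i)

/-- Membership in `𝔥(T(ℝⁿ))`: entire and rapidly decreasing in every horizontal strip. -/
def memFrakRn {n : ℕ} (ψ : (Fin n → ℂ) → ℂ) : Prop :=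
  Differentiable ℂ ψ ∧ ∀ m : ℝ, 0 < m → ∀ N : ℕ, ∃ M : ℝ,
    ∀ z : Fin n → ℂ, (∀ i, |(z i).im| ≤ m) → (1 + cnorm z) ^ N * ‖ψ z‖ ≤ M


/-- Entire functions rapidly decreasing in horizontal strips, measured in the sup norm. -/
def RapidStrip {n : ℕ} (F : (Fin n → ℂ) → ℂ) : Prop :=
  Differentiable ℂ F ∧ ∀ (m : ℝ) (N : ℕ), ∃ M : ℝ,
    ∀ z : Fin n → ℂ, (∀ i, |(z i).im| ≤ m) → (1 + ‖z‖) ^ N * ‖F z‖ ≤ M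

lemma norm_le_cnorm {n : ℕ} (z : Fin n → ℂ) : ‖z‖ ≤ cnorm z := by
  refine (pi_norm_le_iff_of_nonneg (Real.sqrt_nonneg _)).2 fun i => ?_
  refine Real.le_sqrt_of_sq_le ?_
  exact Finset.single_le_sum (f := fun i => ‖z i‖ ^ 2) (fun _ _ => by positivity)
    (Finset.mem_univ i)

lemma abs_le_en {n : ℕ} (y : Fin n → ℝ) (i : Fin n) : |y i| ≤ en y := by
  refine Real.abs_le_sqrt ?_
  exact Finset.single_le_sum (f := fun i => y i ^ 2) (fun _ _ => by positivity)
    (Finset.mem_univ i)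

lemma memFrakRn.rapidStrip {n : ℕ} {ψ : (Fin n → ℂ) → ℂ} (hψ : memFrakRn ψ) :
    RapidStrip ψ := by
  refine ⟨hψ.1, fun m N => ?_⟩
  obtain ⟨M, hM⟩ := hψ.2 (max m 1) (by positivity) N
  refine ⟨M, fun z hz => le_trans ?_ (hM z fun i => (hz i).trans (le_max_left _ _))⟩
  gcongr
  exact norm_le_cnorm z

namespace RapidStrip

variable {n : ℕ} {F : (Fin n → ℂ) → ℂ}

lemma linear_mul (hF : RapidStrip F) (i : Fin n) (a c : ℂ) :
    RapidStrip (fun z => a * (z i + c) * F z) := by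
  refine ⟨by have := hF.1; fun_prop, fun m N => ?_⟩
  obtain ⟨M, hM⟩ := hF.2 m (N + 1)
  refine ⟨‖a‖ * (1 + ‖c‖) * M, fun z hz => ?_⟩
  have h1 : ‖z i + c‖ ≤ (1 + ‖c‖) * (1 + ‖z‖) := by
    have := norm_add_le (z i) c
    have := norm_le_pi_norm z i
    nlinarith [norm_nonneg c, norm_nonneg z]
  calc (1 + ‖z‖) ^ N * ‖a * (z i + c) * F z‖
      = (1 + ‖z‖) ^ N * (‖a‖ * ‖z i + c‖ * ‖F z‖) := by rw [norm_mul, norm_mul]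
    _ ≤ (1 + ‖z‖) ^ N * (‖a‖ * ((1 + ‖c‖) * (1 + ‖z‖)) * ‖F z‖) := by gcongr
    _ = ‖a‖ * (1 + ‖c‖) * ((1 + ‖z‖) ^ (N + 1) * ‖F z‖) := by ring
    _ ≤ _ := by gcongr; exact hM z hz

lemma exp_mul (hF : RapidStrip F) (ξ : Fin n → ℝ) :
    RapidStrip (fun z => F z * exp (I * ∑ i, (ξ i : ℂ) * z i)) := by
  refine ⟨by have := hF.1; fun_prop, fun m N => ?_⟩
  obtain ⟨M, hM⟩ := hF.2 m N
  refine ⟨M * Real.exp (∑ i, |ξ i| * m), fun z hz => ?_⟩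
  have h1 : ‖exp (I * ∑ i, (ξ i : ℂ) * z i)‖ ≤ Real.exp (∑ i, |ξ i| * m) := by
    rw [norm_exp, Real.exp_le_exp]
    have : (I * ∑ i, (ξ i : ℂ) * z i).re = ∑ i, -(ξ i * (z i).im) := by simp
    rw [this]
    refine Finset.sum_le_sum fun i _ => ?_
    calc -(ξ i * (z i).im) ≤ |ξ i * (z i).im| := neg_le_abs _
      _ = |ξ i| * |(z i).im| := abs_mul _ _
      _ ≤ _ := by gcongr; exact hz i
  have h2 := hM z hz
  have h3 : 0 ≤ M := le_trans (by positivity) h2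
  rw [norm_mul, ← mul_assoc]
  gcongr

end RapidStrip

lemma integrable_inv_one_add_norm_pow (n : ℕ) :
    Integrable (fun x : Fin n → ℝ => ((1 + ‖x‖) ^ (n + 1))⁻¹) := by
  have h := integrable_one_add_norm (E := Fin n → ℝ) (μ := volume) (r := (n : ℝ) + 1) (by simp)
  refine h.congr (Eventually.of_forall fun x => ?_)
  have : (0 : ℝ) ≤ 1 + ‖x‖ := by positivity
  simp only [Real.rpow_neg this]
  exact_mod_cast rfl

namespace RapidStrip

variable {n : ℕ} {F : (Fin n → ℂ) → ℂ}

/-- Uniform domination of complex translates of the restriction to `ℝⁿ`. -/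
lemma exists_bound_translate (hF : RapidStrip F) (b : Fin n → ℝ) (R : ℝ) :
    ∃ M : ℝ, ∀ (x : Fin n → ℝ) (w : ℂ), ‖w‖ ≤ R →
      ‖F (fun i => (x i : ℂ) + w * b i)‖ ≤ M * ((1 + ‖x‖) ^ (n + 1))⁻¹ := by
  obtain ⟨M, hM⟩ := hF.2 (R * ‖b‖) (n + 1)
  refine ⟨(1 + R * ‖b‖) ^ (n + 1) * M, fun x w hw => ?_⟩
  have hR : 0 ≤ R := (norm_nonneg _).trans hw
  set z : Fin n → ℂ := fun i => (x i : ℂ) + w * b i with hz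
  have hwb : ∀ i, ‖w * b i‖ ≤ R * ‖b‖ := fun i => by
    rw [norm_mul, norm_real]
    gcongr
    exact norm_le_pi_norm b i
  have h1 := hM z fun i => by
    have : (z i).im = (w * b i).im := by simp [hz]
    rw [this]
    exact (abs_im_le_norm _).trans (hwb i)
  have h2 : ‖x‖ ≤ ‖z‖ + R * ‖b‖ := by
    refine (pi_norm_le_iff_of_nonneg (by positivity)).2 fun i => ?_
    have h3 : (x i : ℂ) = z i - w * b i := by simp [hz]
    rw [← norm_real, h3]
    exact (norm_sub_le _ _).trans (add_le_add (norm_le_pi_norm z i) (hwb i))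
  have h4 : 1 + ‖x‖ ≤ (1 + R * ‖b‖) * (1 + ‖z‖) := by
    nlinarith [norm_nonneg z, mul_nonneg hR (norm_nonneg b)]
  rw [← div_eq_mul_inv, le_div_iff₀ (by positivity)]
  calc ‖F z‖ * (1 + ‖x‖) ^ (n + 1)
      ≤ ‖F z‖ * ((1 + R * ‖b‖) * (1 + ‖z‖)) ^ (n + 1) := by gcongr
    _ = (1 + R * ‖b‖) ^ (n + 1) * ((1 + ‖z‖) ^ (n + 1) * ‖F z‖) := by
        rw [mul_pow]
        ring
    _ ≤ _ := by gcongr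

lemma integrable_translate (hF : RapidStrip F) (b : Fin n → ℝ) (w : ℂ) :
    Integrable (fun x : Fin n → ℝ => F (fun i => (x i : ℂ) + w * b i)) := by
  obtain ⟨M, hM⟩ := hF.exists_bound_translate b ‖w‖
  refine ((integrable_inv_one_add_norm_pow n).const_mul M).mono' ?_
    (Eventually.of_forall fun x => hM x w le_rfl)
  have := hF.1.continuous
  exact Continuous.aestronglyMeasurable (by fun_prop)

lemma integrable (hF : RapidStrip F) :
    Integrable (fun x : Fin n → ℝ => F (fun i => (x i : ℂ))) := by
  simpa using hF.integrable_translate 0 0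

lemma differentiable_integral_translate (hF : RapidStrip F) (b : Fin n → ℝ) :
    Differentiable ℂ (fun w : ℂ => ∫ x : Fin n → ℝ, F (fun i => (x i : ℂ) + w * b i)) := by
  intro w₀
  obtain ⟨M, hM⟩ := hF.exists_bound_translate b (‖w₀‖ + 2)
  have hd : ∀ x : Fin n → ℝ, Differentiable ℂ (fun w : ℂ => F (fun i => (x i : ℂ) + w * b i)) := by
    intro x
    have := hF.1
    fun_prop
  have hc := hF.1.continuous
  refine (hasDerivAt_integral_of_dominated_loc_of_deriv_le
    (F := fun (w : ℂ) (x : Fin n → ℝ) => F (fun i => (x i : ℂ) + w * b i))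
    (F' := fun (w : ℂ) (x : Fin n → ℝ) => deriv (fun w : ℂ => F (fun i => (x i : ℂ) + w * b i)) w)
    (bound := fun x => M * ((1 + ‖x‖) ^ (n + 1))⁻¹)
    (Metric.ball_mem_nhds w₀ one_pos)
    (Eventually.of_forall fun w => (hF.integrable_translate b w).aestronglyMeasurable)
    (hF.integrable_translate b w₀) ?_ ?_ ((integrable_inv_one_add_norm_pow n).const_mul M)
    ?_).2.differentiableAt
  · have : StronglyMeasurable (fun p : (Fin n → ℝ) × ℂ =>
        deriv (fun w : ℂ => F (fun i => (p.1 i : ℂ) + w * b i)) p.2) :=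
      stronglyMeasurable_deriv_with_param
        (f := fun (x : Fin n → ℝ) (w : ℂ) => F (fun i => (x i : ℂ) + w * b i)) (by
          unfold Function.uncurry
          fun_prop)
    exact (this.comp_measurable (measurable_id.prodMk measurable_const)).aestronglyMeasurable
  · refine Eventually.of_forall fun x w hw => ?_
    have hw' : ‖w‖ ≤ ‖w₀‖ + 1 := by
      have h1 := norm_sub_norm_le w w₀
      have h2 := mem_ball_iff_norm.1 hw
      linarith
    have := norm_deriv_le_of_forall_mem_sphere_norm_le (c := w) one_pos (hd x).diffContOnCl
      (C := M * ((1 + ‖x‖) ^ (n + 1))⁻¹) fun v hv => hM x v (by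
        have h1 := norm_sub_norm_le v w
        have h2 := mem_sphere_iff_norm.1 hv
        linarith)
    simpa using this
  · exact Eventually.of_forall fun x w _ => (hd x w).hasDerivAt

/-- Contour shift: the integral over `ℝⁿ + w b` does not depend on `w`. -/
lemma integral_translate (hF : RapidStrip F) (b : Fin n → ℝ) (w : ℂ) :
    ∫ x : Fin n → ℝ, F (fun i => (x i : ℂ) + w * b i) =
      ∫ x : Fin n → ℝ, F (fun i => (x i : ℂ)) := by
  have hΦ := hF.differentiable_integral_translate b
  set Φ : ℂ → ℂ := fun w => ∫ x : Fin n → ℝ, F (fun i => (x i : ℂ) + w * b i) with hΦdef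
  have hper : ∀ (w : ℂ) (t : ℝ), Φ (w + t) = Φ w := by
    intro w t
    rw [hΦdef]
    dsimp only
    rw [← integral_add_right_eq_self
      (fun x : Fin n → ℝ => F (fun i => (x i : ℂ) + w * b i)) (t • b)]
    refine integral_congr_ae (Eventually.of_forall fun x => ?_)
    dsimp only
    congr 1
    funext i
    simp
    ring
  have hder : ∀ w, deriv Φ w = 0 := by
    intro w
    have h1 : HasDerivAt (fun t : ℝ => Φ (w + t)) (deriv Φ w) 0 := by
      have h2 : HasDerivAt (fun t : ℂ => Φ (w + t)) (deriv Φ w) ((0 : ℝ) : ℂ) := by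
        have h3 := (hΦ w).hasDerivAt
        exact HasDerivAt.comp_const_add (f := Φ) (f' := deriv Φ w) w ((0 : ℝ) : ℂ)
          (by simpa using h3)
      exact h2.comp_ofReal
    simp only [hper] at h1
    exact h1.unique (hasDerivAt_const _ _)
  have := is_const_of_deriv_eq_zero hΦ hder w 0
  simpa [hΦdef] using this

end RapidStrip

/-- The unnormalized inverse Fourier transform of the restriction of `F` to `ℝⁿ`. -/
def fourT {n : ℕ} (F : (Fin n → ℂ) → ℂ) (ξ : Fin n → ℝ) : ℂ :=
  ∫ x : Fin n → ℝ, F (fun i => (x i : ℂ)) * exp (I * ∑ i, (ξ i : ℂ) * (x i : ℂ))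

lemma norm_exp_I_mul_pairing {n : ℕ} (ξ x : Fin n → ℝ) :
    ‖exp (I * ∑ i, (ξ i : ℂ) * (x i : ℂ))‖ = 1 := by
  rw [norm_exp]
  simp

lemma hasFDerivAt_pairing {n : ℕ} (y ξ : Fin n → ℝ) :
    HasFDerivAt (fun ξ : Fin n → ℝ => ∑ i, ξ i * y i)
      (∑ i, y i • ContinuousLinearMap.proj (R := ℝ) (φ := fun _ : Fin n => ℝ) i) ξ := by
  refine HasFDerivAt.fun_sum fun i _ => ?_
  have h := (ContinuousLinearMap.proj (R := ℝ) (φ := fun _ : Fin n => ℝ) i).hasFDerivAt (x := ξ)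
  exact h.mul_const (y i)

namespace RapidStrip

variable {n : ℕ} {F : (Fin n → ℂ) → ℂ}

lemma hasFDerivAt_fourT (hF : RapidStrip F) (ξ : Fin n → ℝ) :
    ∃ L : (Fin n → ℝ) →L[ℝ] ℂ, HasFDerivAt (fourT F) L ξ ∧
      ∀ i, L (Pi.single i 1) = fourT (fun z => I * (z i + 0) * F z) ξ := by
  let P : (Fin n → ℝ) → (Fin n → ℝ) →L[ℝ] ℝ := fun x =>
    ∑ i, x i • ContinuousLinearMap.proj (R := ℝ) (φ := fun _ : Fin n => ℝ) i
  let F' : (Fin n → ℝ) → (Fin n → ℝ) → (Fin n → ℝ) →L[ℝ] ℂ := fun ξ x =>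
    (F (fun i => (x i : ℂ)) * exp (I * ∑ i, (ξ i : ℂ) * (x i : ℂ)) * I) •
      (ofRealCLM.comp (P x))
  have hPn : ∀ x, ‖P x‖ ≤ ∑ i, |x i| := fun x => by
    refine (norm_sum_le _ _).trans (Finset.sum_le_sum fun i _ => ?_)
    rw [norm_smul, Real.norm_eq_abs]
    refine mul_le_of_le_one_right (abs_nonneg _) ?_
    refine ContinuousLinearMap.opNorm_le_bound _ zero_le_one fun v => ?_
    simpa using norm_le_pi_norm v i
  have hc := hF.1.continuous
  have hPc : Continuous P := by
    refine continuous_finsetSum _ fun i _ => ?_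
    fun_prop
  have hcomp : Continuous (fun x => ofRealCLM.comp (P x)) :=
    continuous_const.clm_comp hPc
  have hbint : Integrable (fun x : Fin n → ℝ =>
      ∑ i, ‖I * ((x i : ℂ) + 0) * F (fun i => (x i : ℂ))‖) :=
    integrable_finsetSum _ fun i _ => (hF.linear_mul i I 0).integrable.norm
  have hF'm : ∀ ξ, AEStronglyMeasurable (F' ξ) volume := fun ξ => by
    have h : Continuous (fun x : Fin n → ℝ =>
        F (fun i => (x i : ℂ)) * exp (I * ∑ i, (ξ i : ℂ) * (x i : ℂ)) * I) := by fun_prop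
    exact (h.smul hcomp).aestronglyMeasurable
  have hF'b : ∀ ξ x, ‖F' ξ x‖ ≤ ∑ i, ‖I * ((x i : ℂ) + 0) * F (fun i => (x i : ℂ))‖ := by
    intro ξ x
    have h1 : ‖ofRealCLM.comp (P x)‖ ≤ ∑ i, |x i| := by
      refine (ContinuousLinearMap.opNorm_comp_le _ _).trans ?_
      simpa using hPn x
    calc ‖F' ξ x‖ = ‖F (fun i => (x i : ℂ))‖ * ‖ofRealCLM.comp (P x)‖ := by
          simp only [F']
          rw [norm_smul, norm_mul, norm_mul, norm_exp_I_mul_pairing]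
          simp
      _ ≤ ‖F (fun i => (x i : ℂ))‖ * ∑ i, |x i| := by gcongr
      _ = _ := by
          rw [Finset.mul_sum]
          refine Finset.sum_congr rfl fun i _ => ?_
          simp [mul_comm]
  have hint : Integrable (F' ξ) := hbint.mono' (hF'm ξ) (Eventually.of_forall (hF'b ξ))
  have hderiv : ∀ x η : Fin n → ℝ, HasFDerivAt
      (fun ξ : Fin n → ℝ => F (fun i => (x i : ℂ)) * exp (I * ∑ i, (ξ i : ℂ) * (x i : ℂ)))
      (F' η x) η := by
    intro x η
    have h1 := (ofRealCLM.hasFDerivAt (x := ∑ i, η i * x i)).comp η (hasFDerivAt_pairing x η)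
    have h2 := ((h1.const_mul I).cexp).const_mul (F (fun i => (x i : ℂ)))
    convert! h2 using 1
    · funext η
      simp
    · ext v
      simp [F', P]
      ring
  have hFm : ∀ η : Fin n → ℝ, Integrable (fun x : Fin n → ℝ =>
      F (fun i => (x i : ℂ)) * exp (I * ∑ i, (η i : ℂ) * (x i : ℂ))) :=
    fun η => (hF.exp_mul η).integrable
  refine ⟨∫ x, F' ξ x, ?_, fun i => ?_⟩
  · exact hasFDerivAt_integral_of_dominated_of_fderiv_le (s := Set.univ) (𝕜 := ℝ)
      (F := fun ξ x : Fin n → ℝ =>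
        F (fun i => (x i : ℂ)) * exp (I * ∑ i, (ξ i : ℂ) * (x i : ℂ)))
      (F' := F')
      (bound := fun x => ∑ i, ‖I * ((x i : ℂ) + 0) * F (fun i => (x i : ℂ))‖) univ_mem
      (Eventually.of_forall fun η => (hFm η).aestronglyMeasurable) (hFm ξ) (hF'm ξ)
      (Eventually.of_forall fun x η _ => hF'b η x) hbint
      (Eventually.of_forall fun x η _ => hderiv x η)
  · rw [ContinuousLinearMap.integral_apply hint]
    refine integral_congr_ae (Eventually.of_forall fun x => ?_)
    have : P x (Pi.single i 1) = x i := by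
      simp [P, Pi.single_apply]
    simp [F', this]
    ring

lemma continuous_fourT (hF : RapidStrip F) : Continuous (fourT F) :=
  continuous_iff_continuousAt.2 fun ξ =>
    (hF.hasFDerivAt_fourT ξ).choose_spec.1.continuousAt

end RapidStrip

lemma pd_exp_mul_fourT {n : ℕ} {F : (Fin n → ℂ) → ℂ} (hF : RapidStrip F)
    (y : Fin n → ℝ) (c : ℂ) (i : Fin n) :
    pd i (fun ξ => (Real.exp (-(∑ i, ξ i * y i)) : ℂ) * (c * fourT F ξ)) =
      fun ξ => (Real.exp (-(∑ i, ξ i * y i)) : ℂ) *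
        (c * fourT (fun z => I * (z i + I * y i) * F z) ξ) := by
  funext ξ
  obtain ⟨L, hL, hLi⟩ := hF.hasFDerivAt_fourT ξ
  have h1 := (ofRealCLM.hasFDerivAt (x := Real.exp (-(∑ i, ξ i * y i)))).comp ξ
    (hasFDerivAt_pairing y ξ).neg.exp
  have h2 := h1.mul (hL.const_mul c)
  have h3 : fourT (fun z => I * (z i + I * y i) * F z) ξ =
      fourT (fun z => I * (z i + 0) * F z) ξ + -(y i : ℂ) * fourT F ξ := by
    unfold fourT
    rw [← integral_const_mul, ← integral_add
      ((hF.linear_mul i I 0).exp_mul ξ).integrable ((hF.exp_mul ξ).integrable.const_mul _)]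
    refine integral_congr_ae (Eventually.of_forall fun x => ?_)
    dsimp only
    linear_combination (y i : ℂ) * F (fun i => (x i : ℂ)) *
      exp (I * ∑ i, (ξ i : ℂ) * (x i : ℂ)) * I_mul_I
  have h4 : pd i (fun ξ => (Real.exp (-(∑ i, ξ i * y i)) : ℂ) * (c * fourT F ξ)) ξ = _ :=
    congrArg (fun T : (Fin n → ℝ) →L[ℝ] ℂ => T (Pi.single i 1)) h2.fderiv
  rw [h4, h3]
  have h5 : ∑ j, y j * (Pi.single i 1 : Fin n → ℝ) j = y i := by simp [Pi.single_apply]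
  simp [hLi, h5]
  ring

lemma RapidStrip.linear_pow_mul {n : ℕ} {F : (Fin n → ℂ) → ℂ} (hF : RapidStrip F)
    (i : Fin n) (a c : ℂ) (m : ℕ) : RapidStrip (fun z => (a * (z i + c)) ^ m * F z) := by
  induction m with
  | zero => simpa using hF
  | succ m ih => simpa only [pow_succ', mul_assoc] using ih.linear_mul i a c

lemma iterate_pd_exp_mul_fourT {n : ℕ} {F : (Fin n → ℂ) → ℂ} (hF : RapidStrip F)
    (y : Fin n → ℝ) (c : ℂ) (i : Fin n) (m : ℕ) :
    (pd i)^[m] (fun ξ => (Real.exp (-(∑ i, ξ i * y i)) : ℂ) * (c * fourT F ξ)) =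
      fun ξ => (Real.exp (-(∑ i, ξ i * y i)) : ℂ) *
        (c * fourT (fun z => (I * (z i + I * y i)) ^ m * F z) ξ) := by
  induction m with
  | zero => simp
  | succ m ih =>
    rw [Function.iterate_succ_apply', ih,
      pd_exp_mul_fourT (hF.linear_pow_mul i I (I * y i) m)]
    simp only [pow_succ', mul_assoc]

/-- The polynomial `(i (z + i y))^γ`, the symbol of `D^γ` conjugated by `e^{−⟨ξ,y⟩}`. -/
def symb {n : ℕ} (γ : Fin n → ℕ) (y : Fin n → ℝ) (z : Fin n → ℂ) : ℂ :=
  ∏ j, (I * (z j + I * y j)) ^ γ j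

lemma foldr_pd_exp_mul_fourT {n : ℕ} {F : (Fin n → ℂ) → ℂ} (hF : RapidStrip F)
    (γ : Fin n → ℕ) (y : Fin n → ℝ) (c : ℂ) (l : List (Fin n)) :
    RapidStrip (fun z => (l.map fun j => (I * (z j + I * y j)) ^ γ j).prod * F z) ∧
    l.foldr (fun i g => (pd i)^[γ i] g)
        (fun ξ => (Real.exp (-(∑ i, ξ i * y i)) : ℂ) * (c * fourT F ξ)) =
      fun ξ => (Real.exp (-(∑ i, ξ i * y i)) : ℂ) *
        (c * fourT (fun z => (l.map fun j => (I * (z j + I * y j)) ^ γ j).prod * F z) ξ) := by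
  induction l with
  | nil => simpa using hF
  | cons a l ih =>
    refine ⟨by simpa only [List.map_cons, List.prod_cons, mul_assoc] using
      ih.1.linear_pow_mul a I (I * y a) (γ a), ?_⟩
    rw [List.foldr_cons, ih.2, iterate_pd_exp_mul_fourT ih.1]
    simp only [List.map_cons, List.prod_cons, mul_assoc]

lemma RapidStrip.symb_mul {n : ℕ} {F : (Fin n → ℂ) → ℂ} (hF : RapidStrip F)
    (γ : Fin n → ℕ) (y : Fin n → ℝ) : RapidStrip (fun z => symb γ y z * F z) := by
  simpa only [symb, Fin.prod_univ_def] using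
    (foldr_pd_exp_mul_fourT hF γ y 1 (List.finRange n)).1

lemma Dm_exp_mul_fourT {n : ℕ} {F : (Fin n → ℂ) → ℂ} (hF : RapidStrip F)
    (γ : Fin n → ℕ) (y : Fin n → ℝ) (c : ℂ) :
    Dm γ (fun ξ => (Real.exp (-(∑ i, ξ i * y i)) : ℂ) * (c * fourT F ξ)) =
      fun ξ => (Real.exp (-(∑ i, ξ i * y i)) : ℂ) *
        (c * fourT (fun z => symb γ y z * F z) ξ) := by
  simp only [symb, Fin.prod_univ_def]
  exact (foldr_pd_exp_mul_fourT hF γ y c (List.finRange n)).2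

lemma norm_symb_le {n : ℕ} (γ : Fin n → ℕ) {y : Fin n → ℝ} {Q : ℝ}
    (hy : ∀ i, |y i| ≤ Q) (hQ : 0 ≤ Q) (z : Fin n → ℂ) :
    ‖symb γ y z‖ ≤ (1 + Q) ^ mOrd γ * (1 + ‖z‖) ^ mOrd γ := by
  rw [symb, norm_prod, ← mul_pow, mOrd, ← Finset.prod_pow_eq_pow_sum]
  refine Finset.prod_le_prod (fun _ _ => norm_nonneg _) fun i _ => ?_
  rw [norm_pow]
  refine pow_le_pow_left₀ (norm_nonneg _) ?_ _
  have h1 : ‖I * (z i + I * y i)‖ ≤ ‖z i‖ + |y i| := by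
    rw [norm_mul, norm_I, one_mul]
    refine (norm_add_le _ _).trans ?_
    simp
  nlinarith [norm_le_pi_norm z i, hy i, norm_nonneg z]

/-- Exponential decay of the Fourier transforms, uniform for bounded `y`. -/
lemma RapidStrip.exists_bound_fourT_symb {n : ℕ} {F : (Fin n → ℂ) → ℂ} (hF : RapidStrip F)
    (γ : Fin n → ℕ) {m Q : ℝ} (hm : 0 ≤ m) (hQ : 0 ≤ Q) :
    ∃ B : ℝ, 0 ≤ B ∧ ∀ y : Fin n → ℝ, (∀ i, |y i| ≤ Q) → ∀ ξ : Fin n → ℝ,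
      ‖fourT (fun z => symb γ y z * F z) ξ‖ ≤ B * Real.exp (-(m * n1 ξ)) := by
  obtain ⟨M, hM⟩ := hF.2 m (mOrd γ + (n + 1))
  have hM0 : 0 ≤ M := le_trans (by positivity) (hM 0 (by simp [hm]))
  have hJ := integrable_inv_one_add_norm_pow n
  refine ⟨(1 + Q) ^ mOrd γ * M * ∫ x : Fin n → ℝ, ((1 + ‖x‖) ^ (n + 1))⁻¹,
    mul_nonneg (by positivity) (integral_nonneg fun x => by positivity), fun y hy ξ => ?_⟩
  let b : Fin n → ℝ := fun i => if 0 ≤ ξ i then m else -m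
  have hb : ∀ i, ξ i * b i = m * |ξ i| := fun i => by
    by_cases h : 0 ≤ ξ i
    · simp [b, h, abs_of_nonneg h, mul_comm]
    · simp [b, h, abs_of_neg (not_le.1 h), mul_comm]
  have hb' : ∀ i, |b i| ≤ m := fun i => by
    by_cases h : 0 ≤ ξ i <;> simp [b, h, abs_of_nonneg hm]
  have hshift := (((hF.symb_mul γ y).exp_mul ξ).integral_translate b I).symm
  rw [fourT, hshift]
  calc _ ≤ ∫ x : Fin n → ℝ, (1 + Q) ^ mOrd γ * M * Real.exp (-(m * n1 ξ)) *
        ((1 + ‖x‖) ^ (n + 1))⁻¹ := ?_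
    _ = _ := by
      rw [integral_const_mul]
      ring
  refine norm_integral_le_of_norm_le (hJ.const_mul _) (Eventually.of_forall fun x => ?_)
  set z : Fin n → ℂ := fun i => (x i : ℂ) + I * b i with hz
  have hexp : ‖exp (I * ∑ i, (ξ i : ℂ) * z i)‖ = Real.exp (-(m * n1 ξ)) := by
    rw [norm_exp]
    congr 1
    simp [hz, n1, Finset.mul_sum, hb]
  have hxz : ‖x‖ ≤ ‖z‖ := by
    refine (pi_norm_le_iff_of_nonneg (norm_nonneg _)).2 fun i => ?_
    have h1 : x i = (z i).re := by simp [hz]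
    rw [h1]
    exact (abs_re_le_norm _).trans (norm_le_pi_norm z i)
  have hMz := hM z fun i => by simpa [hz] using hb' i
  have hF' : ‖symb γ y z * F z‖ ≤ (1 + Q) ^ mOrd γ * M * ((1 + ‖x‖) ^ (n + 1))⁻¹ := by
    rw [← div_eq_mul_inv, le_div_iff₀ (by positivity), norm_mul]
    calc ‖symb γ y z‖ * ‖F z‖ * (1 + ‖x‖) ^ (n + 1)
        ≤ ((1 + Q) ^ mOrd γ * (1 + ‖z‖) ^ mOrd γ) * ‖F z‖ * (1 + ‖z‖) ^ (n + 1) := by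
          gcongr
          exact norm_symb_le γ hy hQ z
      _ = (1 + Q) ^ mOrd γ * ((1 + ‖z‖) ^ (mOrd γ + (n + 1)) * ‖F z‖) := by ring
      _ ≤ _ := by gcongr
  rw [norm_mul, hexp]
  calc _ ≤ (1 + Q) ^ mOrd γ * M * ((1 + ‖x‖) ^ (n + 1))⁻¹ * Real.exp (-(m * n1 ξ)) := by gcongr
    _ = _ := by ring

lemma integrable_exp_neg_n1 (n : ℕ) :
    Integrable (fun ξ : Fin n → ℝ => Real.exp (-n1 ξ)) := by
  have h1 : Integrable (fun t : ℝ => Real.exp (-|t|)) := by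
    rw [← integrableOn_univ, ← Set.Iic_union_Ioi (a := (0 : ℝ))]
    refine IntegrableOn.union ?_ ?_
    · refine (integrableOn_exp_Iic 0).congr_fun (fun t ht => ?_) measurableSet_Iic
      simp [abs_of_nonpos (Set.mem_Iic.1 ht)]
    · refine (integrableOn_exp_neg_Ioi 0).congr_fun (fun t ht => ?_) measurableSet_Ioi
      simp [abs_of_pos (Set.mem_Ioi.1 ht)]
  have := Integrable.fintype_prod (ι := Fin n) (f := fun _ (t : ℝ) => Real.exp (-|t|))
    fun _ => h1
  refine this.congr (Eventually.of_forall fun ξ => ?_)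
  simp [n1, ← Real.exp_sum]

lemma continuous_n1 {n : ℕ} : Continuous (n1 : (Fin n → ℝ) → ℝ) := by
  unfold n1
  fun_prop

/-- Strong boundedness of the regularized pairings
`G_ψ(y) = (−1)^{|γ|} ∫ e^{k|ξ|₁} g(ξ) D^γ_ξ[e^{−⟨ξ,y⟩} φ(ξ)] dξ`. -/
theorem stmt_12 {n : ℕ} (C C' : Set (Fin n → ℝ))
    (hCo : IsOpen C) (hCc : Convex ℝ C) (hCcone : IsCone C)
    (hsub : CmpSub C' C)
    (δ : ℝ) (hδ : 0 < δ)
    (hsep : ∀ ξ ∈ dualCone C, ∀ y ∈ C', δ * (en ξ * en y) ≤ ∑ i, ξ i * y i)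
    (k : ℝ) (hk : 0 ≤ k) (γ : Fin n → ℕ)
    (g : (Fin n → ℝ) → ℂ) (hgc : Continuous g) (hgb : ∃ M : ℝ, ∀ ξ, ‖g ξ‖ ≤ M)
    (hsupp : Function.support g ⊆ dualCone C)
    (r : ℝ) (hr : 0 < r)
    (hconv : ∀ z : Fin n → ℂ, imv z ∈ C' → r ≤ en (imv z) →
      Integrable (fun ξ : Fin n → ℝ =>
        (Real.exp (k * n1 ξ) : ℂ) * g ξ * Complex.exp (Complex.I * ∑ i, (ξ i : ℂ) * z i)))
    (ψ : (Fin n → ℂ) → ℂ) (hψ : memFrakRn ψ)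
    (φ : (Fin n → ℝ) → ℂ)
    (hφ : φ = fun ξ => (((2 * Real.pi) ^ n : ℝ) : ℂ)⁻¹ *
      ∫ x : Fin n → ℝ,
        ψ (fun i => (x i : ℂ)) * Complex.exp (Complex.I * ∑ i, (ξ i : ℂ) * (x i : ℂ)))
    (G : (Fin n → ℝ) → ℂ)
    (hG : G = fun y => (-1 : ℂ) ^ mOrd γ *
      ∫ ξ : Fin n → ℝ, (Real.exp (k * n1 ξ) : ℂ) * g ξ *
        Dm γ (fun ξ' => (Real.exp (-(∑ i, ξ' i * y i)) : ℂ) * φ ξ') ξ) :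
    (∀ y ∈ insert (0 : Fin n → ℝ) C',
      Integrable (fun ξ : Fin n → ℝ => (Real.exp (k * n1 ξ) : ℂ) * g ξ *
        Dm γ (fun ξ' => (Real.exp (-(∑ i, ξ' i * y i)) : ℂ) * φ ξ') ξ)) ∧
    (∀ y ∈ C', r ≤ en y →
      Integrable (fun x : Fin n → ℝ =>
        FL k γ g (fun i => (x i : ℂ) + (y i : ℂ) * Complex.I) * ψ (fun i => (x i : ℂ))) ∧
      G y = ∫ x : Fin n → ℝ,
        FL k γ g (fun i => (x i : ℂ) + (y i : ℂ) * Complex.I) * ψ (fun i => (x i : ℂ))) ∧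
    (∀ Q : ℝ, 0 < Q → ∃ B : ℝ, ∀ y ∈ C', en y ≤ Q → ‖G y‖ ≤ B) := by
  set c : ℂ := (((2 * Real.pi) ^ n : ℝ) : ℂ)⁻¹ with hc
  have hψ' := hψ.rapidStrip
  obtain ⟨Mg, hMg⟩ := hgb
  have hMg0 : 0 ≤ Mg := (norm_nonneg _).trans (hMg 0)
  have hD : ∀ y : Fin n → ℝ, Dm γ (fun ξ' => (Real.exp (-(∑ i, ξ' i * y i)) : ℂ) * φ ξ') =
      fun ξ => (Real.exp (-(∑ i, ξ i * y i)) : ℂ) *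
        (c * fourT (fun z => symb γ y z * ψ z) ξ) := fun y => by
    rw [← Dm_exp_mul_fourT hψ' γ y c, hφ]
    rfl
  have hpos : ∀ y ∈ insert (0 : Fin n → ℝ) C', ∀ ξ ∈ dualCone C, 0 ≤ ∑ i, ξ i * y i := by
    rintro y (rfl | hy) ξ hξ
    · simp
    · refine le_trans ?_ (hsep ξ hξ y hy)
      exact mul_nonneg hδ.le (mul_nonneg (Real.sqrt_nonneg _) (Real.sqrt_nonneg _))
  have hbound : ∀ Q : ℝ, 0 ≤ Q → ∃ B : ℝ, ∀ y ∈ insert (0 : Fin n → ℝ) C', (∀ i, |y i| ≤ Q) →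
      ∀ ξ, ‖(Real.exp (k * n1 ξ) : ℂ) * g ξ *
        Dm γ (fun ξ' => (Real.exp (-(∑ i, ξ' i * y i)) : ℂ) * φ ξ') ξ‖ ≤
        B * Real.exp (-n1 ξ) := by
    intro Q hQ
    obtain ⟨B, hB0, hB⟩ := hψ'.exists_bound_fourT_symb γ (m := k + 1) (by positivity) hQ
    refine ⟨Mg * (‖c‖ * B), fun y hy hyQ ξ => ?_⟩
    by_cases hgξ : g ξ = 0
    · rw [hgξ]
      simp only [mul_zero, zero_mul, norm_zero]
      positivity
    have hle : Real.exp (-(∑ i, ξ i * y i)) ≤ 1 :=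
      Real.exp_le_one_iff.2 (neg_nonpos.2 (hpos y hy ξ (hsupp hgξ)))
    rw [hD]
    simp only [norm_mul, norm_real, Real.norm_eq_abs, Real.abs_exp]
    calc Real.exp (k * n1 ξ) * ‖g ξ‖ * (Real.exp (-(∑ i, ξ i * y i)) *
          (‖c‖ * ‖fourT (fun z => symb γ y z * ψ z) ξ‖))
        ≤ Real.exp (k * n1 ξ) * Mg * (1 * (‖c‖ * (B * Real.exp (-((k + 1) * n1 ξ))))) := by
          gcongr
          · exact hMg ξ
          · exact hB y hyQ ξ
      _ = Mg * (‖c‖ * B) * (Real.exp (k * n1 ξ) * Real.exp (-((k + 1) * n1 ξ))) := by ring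
      _ = _ := by
        rw [← Real.exp_add]
        ring_nf
  have hN := integrable_exp_neg_n1 n
  refine ⟨fun y hy => ?_, fun y hy hry => ?_, fun Q hQ => ?_⟩
  · obtain ⟨B, hB⟩ := hbound (en y) (Real.sqrt_nonneg _)
    refine (hN.const_mul B).mono' ?_ (Eventually.of_forall (hB y hy (abs_le_en y)))
    rw [hD]
    have h1 := (hψ'.symb_mul γ y).continuous_fourT
    have h2 := continuous_n1 (n := n)
    exact Continuous.aestronglyMeasurable (by fun_prop)
  · have him : imv (fun i => (y i : ℂ) * I) = y := by
      funext i
      simp [imv]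
    have hA := hconv (fun i => (y i : ℂ) * I) (by rwa [him]) (by rwa [him])
    have hP := (hψ'.symb_mul γ y).integrable
    have hK : Integrable (Function.uncurry fun (ξ x : Fin n → ℝ) =>
        exp (I * ∑ i, (ξ i : ℂ) * (x i : ℂ)) *
        (((Real.exp (k * n1 ξ) : ℂ) * g ξ * exp (I * ∑ i, (ξ i : ℂ) * ((y i : ℂ) * I))) *
        (symb γ y (fun i => (x i : ℂ)) * ψ (fun i => (x i : ℂ))))) (volume.prod volume) := by
      refine (hA.mul_prod hP).bdd_mul (c := 1)
        (f := fun p : (Fin n → ℝ) × (Fin n → ℝ) => exp (I * ∑ i, (p.1 i : ℂ) * (p.2 i : ℂ))) ?_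
        (Eventually.of_forall fun p => (norm_exp_I_mul_pairing p.1 p.2).le)
      exact Continuous.aestronglyMeasurable (by fun_prop)
    have hin : ∀ x : Fin n → ℝ,
        FL k γ g (fun i => (x i : ℂ) + (y i : ℂ) * I) * ψ (fun i => (x i : ℂ)) =
        ((-1) ^ mOrd γ * c) * ∫ ξ : Fin n → ℝ, exp (I * ∑ i, (ξ i : ℂ) * (x i : ℂ)) *
        (((Real.exp (k * n1 ξ) : ℂ) * g ξ * exp (I * ∑ i, (ξ i : ℂ) * ((y i : ℂ) * I))) *
        (symb γ y (fun i => (x i : ℂ)) * ψ (fun i => (x i : ℂ)))) := by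
      intro x
      have h1 : ∏ j, (-I * ((x j : ℂ) + (y j : ℂ) * I)) ^ γ j =
          (-1) ^ mOrd γ * symb γ y (fun i => (x i : ℂ)) := by
        rw [mOrd, ← Finset.prod_pow_eq_pow_sum, symb, ← Finset.prod_mul_distrib]
        refine Finset.prod_congr rfl fun j _ => ?_
        rw [← mul_pow]
        ring
      have h2 : ∫ ξ : Fin n → ℝ, exp (I * ∑ i, (ξ i : ℂ) * (x i : ℂ)) *
          (((Real.exp (k * n1 ξ) : ℂ) * g ξ * exp (I * ∑ i, (ξ i : ℂ) * ((y i : ℂ) * I))) *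
          (symb γ y (fun i => (x i : ℂ)) * ψ (fun i => (x i : ℂ)))) =
          (∫ ξ : Fin n → ℝ, (Real.exp (k * n1 ξ) : ℂ) * g ξ *
            exp (I * ∑ i, (ξ i : ℂ) * ((x i : ℂ) + (y i : ℂ) * I))) *
          (symb γ y (fun i => (x i : ℂ)) * ψ (fun i => (x i : ℂ))) := by
        rw [← integral_mul_const]
        refine integral_congr_ae (Eventually.of_forall fun ξ => ?_)
        have : I * ∑ i, (ξ i : ℂ) * ((x i : ℂ) + (y i : ℂ) * I) =
            I * ∑ i, (ξ i : ℂ) * (x i : ℂ) + I * ∑ i, (ξ i : ℂ) * ((y i : ℂ) * I) := by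
          rw [← mul_add, ← Finset.sum_add_distrib]
          simp only [mul_add]
        dsimp only
        rw [this, Complex.exp_add]
        ring
      rw [h2, FL, h1]
      ring
    simp only [hin]
    refine ⟨hK.integral_prod_right.const_mul _, ?_⟩
    rw [integral_const_mul, ← integral_integral_swap hK, hG]
    dsimp only
    rw [mul_assoc, ← integral_const_mul c, hD]
    congr 1
    refine integral_congr_ae (Eventually.of_forall fun ξ => ?_)
    have hexp : exp (I * ∑ i, (ξ i : ℂ) * ((y i : ℂ) * I)) =
        (Real.exp (-(∑ i, ξ i * y i)) : ℂ) := by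
      rw [ofReal_exp]
      congr 1
      push_cast
      rw [← Finset.sum_neg_distrib, Finset.mul_sum]
      refine Finset.sum_congr rfl fun i _ => ?_
      linear_combination (ξ i : ℂ) * y i * I_mul_I
    dsimp only
    rw [hexp, fourT, ← integral_const_mul c, ← integral_const_mul, ← integral_const_mul,
      ← integral_const_mul]
    refine integral_congr_ae (Eventually.of_forall fun x => ?_)
    dsimp only
    ring
  · obtain ⟨B, hB⟩ := hbound Q hQ.le
    refine ⟨∫ ξ : Fin n → ℝ, B * Real.exp (-n1 ξ), fun y hy hyQ => ?_⟩
    rw [hG]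
    simp only [norm_mul, norm_pow, norm_neg, norm_one, one_pow, one_mul]
    exact norm_integral_le_of_norm_le (hN.const_mul B) (Eventually.of_forall
      (hB y (Set.mem_insert_of_mem _ hy) fun i => (abs_le_en y i).trans hyQ))
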